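/- For every ν ∈ [-1/2, 1) and every real x > 0, one has (1 + (1+2ν)x/3)·(1 + (1−ν)x/3)² ≥ (1 + x)^{C̃_ν} · (1 + x/3)^{3(1−C̃_ν)}, where C̃_ν = ν²(5−2ν)/3. -/

import Mathlib

/-- The logarithm of the ratio of the two sides, in the variable `y = x / 3`. -/
noncomputable def logRatio (ν y : ℝ) : ℝ :=
  Real.log (1 + (1 + 2 * ν) * y) + 2 * Real.log (1 + (1 - ν) * y)
    - (ν ^ 2 * (5 - 2 * ν) / 3) * Real.log (1 + 3 * y)
    - 3 * (1 - ν ^ 2 * (5 - 2 * ν) / 3) * Real.log (1 + 1 * y)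

theorem hasDerivAt_log_one_add_mul (c y : ℝ) (h : 1 + c * y ≠ 0) :
    HasDerivAt (fun t => Real.log (1 + c * t)) (c / (1 + c * y)) y := by
  have h1 : HasDerivAt (fun t : ℝ => 1 + c * t) c y := by
    simpa using ((hasDerivAt_id y).const_mul c).const_add 1
  exact h1.log h

theorem hasDerivAt_logRatio {ν y : ℝ} (hν1 : -1/2 ≤ ν) (hν2 : ν < 1) (hy : 0 ≤ y) :
    HasDerivAt (logRatio ν)
      (3 * (4 * ν ^ 2 * (1 - ν) / 3 * y + 2 * ν ^ 2 / 3 * ((1 + 2 * ν) * (1 - ν)) * y ^ 2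
          + 2 * (ν ^ 2 * (5 - 2 * ν) / 3) * ((1 + 2 * ν) * (1 - ν)) * y ^ 3)
        / ((1 + (1 + 2 * ν) * y) * (1 + (1 - ν) * y) * (1 + 3 * y) * (1 + 1 * y))) y := by
  have ha : 0 ≤ 1 + 2 * ν := by linarith
  have hb : 0 ≤ 1 - ν := by linarith
  have h1 : 1 + (1 + 2 * ν) * y ≠ 0 := by positivity
  have h2 : 1 + (1 - ν) * y ≠ 0 := by positivity
  have h3 : 1 + 3 * y ≠ 0 := by positivity
  have h4 : 1 + 1 * y ≠ 0 := by positivity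
  have h := (((hasDerivAt_log_one_add_mul _ y h1).add
    ((hasDerivAt_log_one_add_mul _ y h2).const_mul 2)).sub
    ((hasDerivAt_log_one_add_mul _ y h3).const_mul (ν ^ 2 * (5 - 2 * ν) / 3))).sub
    ((hasDerivAt_log_one_add_mul _ y h4).const_mul (3 * (1 - ν ^ 2 * (5 - 2 * ν) / 3)))
  refine HasDerivAt.congr_deriv (f := logRatio ν) h ?_
  field_simp
  ring

theorem logRatio_nonneg {ν y : ℝ} (hν1 : -1/2 ≤ ν) (hν2 : ν < 1) (hy : 0 ≤ y) :
    0 ≤ logRatio ν y := by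
  have ha : 0 ≤ 1 + 2 * ν := by linarith
  have hb : 0 ≤ 1 - ν := by linarith
  have hc : 0 ≤ 5 - 2 * ν := by linarith
  have hmono : MonotoneOn (logRatio ν) (Set.Ici 0) := by
    refine monotoneOn_of_deriv_nonneg (convex_Ici 0)
      (fun t ht => (hasDerivAt_logRatio hν1 hν2 ht).continuousAt.continuousWithinAt)
      (fun t ht => ?_) (fun t ht => ?_)
    · exact (hasDerivAt_logRatio hν1 hν2
        (interior_subset ht)).differentiableAt.differentiableWithinAt
    · have ht0 : 0 ≤ t := interior_subset ht
      rw [(hasDerivAt_logRatio hν1 hν2 ht0).deriv]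
      positivity
  have h0 : logRatio ν 0 = 0 := by simp [logRatio]
  exact h0 ▸ hmono Set.self_mem_Ici hy hy

theorem stmt_1 (ν x : ℝ) (hν1 : -1/2 ≤ ν) (hν2 : ν < 1) (hx : 0 < x) :
    (1 + (1+2*ν)*x/3) * (1 + (1-ν)*x/3)^2
      ≥ (1 + x) ^ (ν^2 * (5 - 2*ν) / 3) * (1 + x/3) ^ (3 * (1 - ν^2 * (5 - 2*ν) / 3)) := by
  have ha : 0 ≤ 1 + 2 * ν := by linarith
  have hb : 0 ≤ 1 - ν := by linarith
  have h := logRatio_nonneg hν1 hν2 (show 0 ≤ x / 3 by positivity)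
  rw [logRatio, ← mul_div_assoc, ← mul_div_assoc, mul_div_cancel₀ x three_ne_zero, one_mul] at h
  have h1 : 0 < 1 + (1 + 2 * ν) * x / 3 := by positivity
  have h2 : 0 < 1 + (1 - ν) * x / 3 := by positivity
  have h3 : 0 < 1 + x := by positivity
  have h4 : 0 < 1 + x / 3 := by positivity
  rw [ge_iff_le, ← Real.log_le_log_iff (by positivity) (by positivity),
    Real.log_mul (by positivity) (by positivity), Real.log_mul (by positivity) (by positivity),
    Real.log_rpow h3, Real.log_rpow h4, Real.log_pow]
  push_cast
  linarith
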